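/- Let α, β > 0 with √α + √β ≥ √2. Then for every κ ≥ 0, every T > 0, and every C¹ loop γ : [0,T] → ℝ² with γ(0) = γ(T), one has ∫₀ᵀ (L(γ(t), γ'(t)) + κ) dt ≥ κT. In particular, for every κ > 0 no loop has negative free-period action S_κ. -/

import Mathlib

/-- Lagrangian of the planar electromagnetic toy model:
`L((x,y),(v₁,v₂)) = ½(v₁²+v₂²) − y v₁ + x v₂ + αx² + βy²`. -/
noncomputable def toyLag (α β : ℝ) (q v : ℝ × ℝ) : ℝ :=
  (1/2)*(v.1^2 + v.2^2) - q.2*v.1 + q.1*v.2 + α*q.1^2 + β*q.2^2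

/-- If `√α + √β ≥ √2`, every C¹ loop has free-period action `S_κ ≥ κT`,
so no loop has negative action for `κ > 0`. -/
theorem stmt_8 (α β : ℝ) (hα : 0 < α) (hβ : 0 < β)
    (h : Real.sqrt 2 ≤ Real.sqrt α + Real.sqrt β) :
    ∀ κ : ℝ, 0 ≤ κ → ∀ T : ℝ, 0 < T → ∀ γ : ℝ → ℝ × ℝ,
      ContDiff ℝ 1 γ → γ 0 = γ T →
      κ * T ≤ ∫ t in (0:ℝ)..T, (toyLag α β (γ t) (deriv γ t) + κ) := by
  intro κ hκ T hT γ hγ hloop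
  obtain ⟨C, hC1, hC2⟩ : ∃ C : ℝ, (1 + C)^2 ≤ 2*β ∧ (1 - C)^2 ≤ 2*α := by
    have ha : 0 < Real.sqrt α := Real.sqrt_pos.mpr hα
    have hb : 0 < Real.sqrt β := Real.sqrt_pos.mpr hβ
    have ha2 : Real.sqrt α ^ 2 = α := Real.sq_sqrt hα.le
    have hb2 : Real.sqrt β ^ 2 = β := Real.sq_sqrt hβ.le
    have h2 : Real.sqrt 2 ^ 2 = 2 := Real.sq_sqrt (by norm_num)
    have h20 : 0 ≤ Real.sqrt 2 := Real.sqrt_nonneg 2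
    generalize Real.sqrt α = a at *
    generalize Real.sqrt β = b at *
    have hs : 0 < a + b := by positivity
    have hs2 : 2 ≤ (a + b)^2 := by
      rw [← h2]
      gcongr
    refine ⟨2*b/(a+b) - 1, ?_, ?_⟩
    · have e : 1 + (2*b/(a+b) - 1) = 2*b/(a+b) := by ring
      rw [e, div_pow, div_le_iff₀ (by positivity), ← hb2]
      nlinarith [sq_nonneg b]
    · have e : 1 - (2*b/(a+b) - 1) = 2*a/(a+b) := by
        field_simp
        ring
      rw [e, div_pow, div_le_iff₀ (by positivity), ← ha2]
      nlinarith [sq_nonneg a]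
  have hd : ∀ t, HasDerivAt γ (deriv γ t) t := fun t =>
    (hγ.differentiable (by norm_num) t).hasDerivAt
  have hc : Continuous γ := hγ.continuous
  have hdc : Continuous (deriv γ) := hγ.continuous_deriv (by norm_num)
  have hd1 : ∀ t, HasDerivAt (fun s => (γ s).1) (deriv γ t).1 t := fun t =>
    (hasFDerivAt_fst (𝕜 := ℝ) (p := γ t)).comp_hasDerivAt t (hd t)
  have hd2 : ∀ t, HasDerivAt (fun s => (γ s).2) (deriv γ t).2 t := fun t =>
    (hasFDerivAt_snd (𝕜 := ℝ) (p := γ t)).comp_hasDerivAt t (hd t)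
  have hF : ∀ t, HasDerivAt (fun s => C * ((γ s).1 * (γ s).2) + κ * s)
      (C * ((deriv γ t).1 * (γ t).2 + (γ t).1 * (deriv γ t).2) + κ) t := fun t => by
    have h1 := (((hd1 t).mul (hd2 t)).const_mul C).add ((hasDerivAt_id t).const_mul κ)
    rw [mul_one] at h1
    exact h1
  have hcont : Continuous
      (fun t => C * ((deriv γ t).1 * (γ t).2 + (γ t).1 * (deriv γ t).2) + κ) := by fun_prop
  have hcont2 : Continuous (fun t => toyLag α β (γ t) (deriv γ t) + κ) := by
    unfold toyLag
    fun_prop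
  have hint := intervalIntegral.integral_eq_sub_of_hasDerivAt (a := 0) (b := T)
    (fun t _ => hF t) (hcont.intervalIntegrable 0 T)
  have hle : ∀ t, C * ((deriv γ t).1 * (γ t).2 + (γ t).1 * (deriv γ t).2) + κ
      ≤ toyLag α β (γ t) (deriv γ t) + κ := by
    intro t
    simp only [toyLag]
    generalize (γ t).1 = x
    generalize (γ t).2 = y
    generalize (deriv γ t).1 = v
    generalize (deriv γ t).2 = w
    nlinarith [sq_nonneg (v - (1+C)*y), sq_nonneg (w + (1-C)*x),
      mul_nonneg (sub_nonneg.mpr hC1) (sq_nonneg y),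
      mul_nonneg (sub_nonneg.mpr hC2) (sq_nonneg x)]
  have hmono := intervalIntegral.integral_mono_on (μ := MeasureTheory.volume) hT.le (hcont.intervalIntegrable 0 T)
    (hcont2.intervalIntegrable 0 T) (fun t _ => hle t)
  rw [hint, hloop] at hmono
  linarith
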